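/- For every real Δ > 0 and every complex s with Re(s) > 1, one has (Δ/π)^s Γ(s) ζ⁽²⁾(s,Δ) = F(s,Δ), where F(s,Δ) = −(1/2)(1/(1−s) + 1/s) + (1/2)∫₀¹ (t^{s−1} + t^{−s}) (θ₃(e^{−πtΔ}) θ₃(e^{−πt/Δ}) − 1/t) dt. -/

import Mathlib

open MeasureTheory

/-- The Jacobi theta function `θ₃(q) = Σ_{j∈ℤ} q^{j²}`. -/
noncomputable def theta3 (q : ℝ) : ℝ := ∑' j : ℤ, q ^ (j ^ 2)

/-- The two-dimensional Epstein zeta function on the rectangular lattice with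
spacings `1` and `Δ`:  `ζ⁽²⁾(s,Δ) = (1/2) Σ'_{(j,k)≠(0,0)} (j² + Δ²k²)^(-s)`. -/
noncomputable def epsteinZeta2 (s : ℂ) (Δ : ℝ) : ℂ :=
  (1 / 2) * ∑' p : {p : ℤ × ℤ // p ≠ 0},
    (((p.1.1 : ℝ) ^ 2 + Δ ^ 2 * (p.1.2 : ℝ) ^ 2 : ℝ) : ℂ) ^ (-s)

/-- The analytic continuation
`F(s,Δ) = -(1/2)(1/(1-s) + 1/s)
   + (1/2)∫₀¹ (t^{s-1} + t^{-s}) (θ₃(e^{-πtΔ}) θ₃(e^{-πt/Δ}) - 1/t) dt`. -/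
noncomputable def F (s : ℂ) (Δ : ℝ) : ℂ :=
  -(1 / 2) * (1 / (1 - s) + 1 / s) +
    (1 / 2) * ∫ t in Set.Ioo (0 : ℝ) 1,
      ((t : ℂ) ^ (s - 1) + (t : ℂ) ^ (-s)) *
        ((theta3 (Real.exp (-(Real.pi * t * Δ))) *
            theta3 (Real.exp (-(Real.pi * t / Δ))) - 1 / t : ℝ) : ℂ)

open Set Filter Asymptotics HurwitzZeta

lemma theta3_exp_neg_pi_mul {x : ℝ} (hx : 0 < x) :
    theta3 (Real.exp (-(Real.pi * x))) = evenKernel 0 x := by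
  have h := (hasSum_int_evenKernel 0 hx).tsum_eq
  rw [QuotientAddGroup.mk_zero] at h
  rw [← h, theta3]
  refine tsum_congr fun j ↦ ?_
  rw [← Real.rpow_intCast, ← Real.exp_mul]
  push_cast
  ring_nf

lemma evenKernel_zero_one_div {x : ℝ} (hx : 0 < x) :
    evenKernel 0 (1 / x) = x ^ (1 / 2 : ℝ) * evenKernel 0 x := by
  rw [evenKernel_functional_equation, ← evenKernel_eq_cosKernel_of_zero, one_div_one_div,
    Real.div_rpow zero_le_one hx.le, Real.one_rpow, one_div_one_div]

lemma isBigO_atTop_evenKernel_zero_mul_sub_one {c : ℝ} (hc : 0 < c) (r : ℝ) :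
    (fun t ↦ evenKernel 0 (t * c) - 1) =O[atTop] (· ^ r) := by
  obtain ⟨p, hp, h⟩ := isBigO_atTop_evenKernel_sub 0
  have h' := h.comp_tendsto (tendsto_id.atTop_mul_const hc)
  simp only [if_true] at h'
  refine h'.trans ((isLittleO_exp_neg_mul_rpow_atTop (mul_pos hp hc) r).isBigO.congr_left ?_)
  intro t
  simp only [Function.comp_apply, id]
  ring_nf

/-- The theta function `θ₃(e^{-πtΔ}) θ₃(e^{-πt/Δ})` of the rectangular lattice. -/
noncomputable def rectTheta (Δ t : ℝ) : ℝ := evenKernel 0 (t * Δ) * evenKernel 0 (t / Δ)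

lemma theta3_mul_theta3 {Δ t : ℝ} (hΔ : 0 < Δ) (ht : 0 < t) :
    theta3 (Real.exp (-(Real.pi * t * Δ))) * theta3 (Real.exp (-(Real.pi * t / Δ))) =
      rectTheta Δ t := by
  rw [mul_assoc, mul_div_assoc, theta3_exp_neg_pi_mul (by positivity),
    theta3_exp_neg_pi_mul (by positivity), rectTheta]

lemma continuousOn_rectTheta {Δ : ℝ} (hΔ : 0 < Δ) : ContinuousOn (rectTheta Δ) (Ioi 0) := by
  refine ContinuousOn.mul ?_ ?_
  · exact (continuousOn_evenKernel 0).comp (by fun_prop) fun t ht ↦ mul_pos ht hΔ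
  · exact (continuousOn_evenKernel 0).comp (by fun_prop) fun t ht ↦ div_pos ht hΔ

lemma rectTheta_one_div {Δ t : ℝ} (hΔ : 0 < Δ) (ht : 0 < t) :
    rectTheta Δ (1 / t) = t * rectTheta Δ t := by
  have h1 : 1 / t * Δ = 1 / (t / Δ) := by field_simp
  have h2 : 1 / t / Δ = 1 / (t * Δ) := by field_simp
  have h3 : (t / Δ) ^ (1 / 2 : ℝ) * (t * Δ) ^ (1 / 2 : ℝ) = t := by
    rw [← Real.mul_rpow (by positivity) (by positivity),
      show t / Δ * (t * Δ) = t ^ 2 by field_simp, ← Real.sqrt_eq_rpow, Real.sqrt_sq ht.le]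
  rw [rectTheta, h1, h2, evenKernel_zero_one_div (by positivity),
    evenKernel_zero_one_div (by positivity), rectTheta]
  linear_combination evenKernel 0 (t * Δ) * evenKernel 0 (t / Δ) * h3

lemma isBigO_atTop_rectTheta_sub_one {Δ : ℝ} (hΔ : 0 < Δ) (r : ℝ) :
    (fun t ↦ rectTheta Δ t - 1) =O[atTop] (· ^ r) := by
  have h1 := isBigO_atTop_evenKernel_zero_mul_sub_one hΔ
  have h2 := isBigO_atTop_evenKernel_zero_mul_sub_one (inv_pos.mpr hΔ)
  have h3 := (h1 r).mul (h2 0)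
  simp only [Real.rpow_zero, mul_one] at h3
  refine ((h3.add (h1 r)).add (h2 r)).congr_left fun t ↦ ?_
  rw [rectTheta, div_eq_mul_inv]
  ring

/-- The theta function of the rectangular lattice, paired with itself under `t ↦ 1 / t`. -/
noncomputable def rectThetaFEPair {Δ : ℝ} (hΔ : 0 < Δ) : WeakFEPair ℂ where
  f := fun t ↦ (rectTheta Δ t : ℂ)
  g := fun t ↦ (rectTheta Δ t : ℂ)
  k := 1
  ε := 1
  f₀ := 1
  g₀ := 1
  hf_int := (Complex.continuous_ofReal.comp_continuousOn
    (continuousOn_rectTheta hΔ)).locallyIntegrableOn measurableSet_Ioi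
  hg_int := (Complex.continuous_ofReal.comp_continuousOn
    (continuousOn_rectTheta hΔ)).locallyIntegrableOn measurableSet_Ioi
  hk := one_pos
  hε := one_ne_zero
  h_feq t ht := by simp [rectTheta_one_div hΔ ht, -one_div]
  hf_top r := by
    simpa using (Complex.isBigO_ofReal_left.mpr (isBigO_atTop_rectTheta_sub_one hΔ r))
  hg_top r := by
    simpa using (Complex.isBigO_ofReal_left.mpr (isBigO_atTop_rectTheta_sub_one hΔ r))

lemma hasSum_rectTheta {Δ t : ℝ} (hΔ : 0 < Δ) (ht : 0 < t) :
    HasSum (fun p : ℤ × ℤ ↦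
      Real.exp (-Real.pi * (((p.1 : ℝ) ^ 2 + Δ ^ 2 * (p.2 : ℝ) ^ 2) / Δ) * t))
      (rectTheta Δ t) := by
  have h1 := hasSum_int_evenKernel 0 (div_pos ht hΔ)
  have h2 := hasSum_int_evenKernel 0 (mul_pos ht hΔ)
  rw [QuotientAddGroup.mk_zero] at h1 h2
  have h := h1.mul h2 (h1.summable.mul_of_nonneg h2.summable
    (fun _ ↦ (Real.exp_pos _).le) fun _ ↦ (Real.exp_pos _).le)
  rw [rectTheta, mul_comm]
  convert! h using 2 with p
  rw [← Real.exp_add]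
  congr 1
  field_simp
  ring

lemma hasSum_rectTheta_sub_one {Δ t : ℝ} (hΔ : 0 < Δ) (ht : 0 < t) :
    HasSum (fun p : {p : ℤ × ℤ // p ≠ 0} ↦
      Real.exp (-Real.pi * (((p.1.1 : ℝ) ^ 2 + Δ ^ 2 * (p.1.2 : ℝ) ^ 2) / Δ) * t))
      (rectTheta Δ t - 1) := by
  have h := hasSum_ite_sub_hasSum (hasSum_rectTheta hΔ ht) 0
  simp only [Prod.fst_zero, Prod.snd_zero, Int.cast_zero, ne_eq, OfNat.ofNat_ne_zero,
    not_false_eq_true, zero_pow, mul_zero, add_zero, zero_div, zero_mul, Real.exp_zero] at h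
  refine (hasSum_subtype_iff_indicator (s := {p : ℤ × ℤ | p ≠ 0})
    (f := fun p : ℤ × ℤ ↦
      Real.exp (-Real.pi * (((p.1 : ℝ) ^ 2 + Δ ^ 2 * (p.2 : ℝ) ^ 2) / Δ) * t))).mpr ?_
  convert! h using 2 with p
  by_cases hp : p = 0 <;> simp [hp]

lemma rect_norm_sq_pos {Δ : ℝ} (hΔ : 0 < Δ) {p : ℤ × ℤ} (hp : p ≠ 0) :
    0 < (p.1 : ℝ) ^ 2 + Δ ^ 2 * (p.2 : ℝ) ^ 2 := by
  by_cases h1 : p.1 = 0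
  · have h2 : p.2 ≠ 0 := fun h2 ↦ hp (Prod.ext h1 h2)
    positivity
  · positivity

lemma summable_rect_rpow {Δ : ℝ} (hΔ : 0 < Δ) {σ : ℝ} (hσ : 1 < σ) :
    Summable fun p : ℤ × ℤ ↦ ((p.1 : ℝ) ^ 2 + Δ ^ 2 * (p.2 : ℝ) ^ 2) ^ (-σ) := by
  let z : UpperHalfPlane := ⟨⟨0, Δ⟩, hΔ⟩
  have h1 := (EisensteinSeries.summable_one_div_norm_rpow
    (show 2 < 2 * σ by linarith)).mul_left (EisensteinSeries.r z ^ (-(2 * σ)))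
  have h2 := Summable.of_nonneg_of_le (fun x ↦ by positivity)
    (EisensteinSeries.summand_bound z (by linarith : 0 ≤ 2 * σ)) h1
  let e : ℤ × ℤ ≃ (Fin 2 → ℤ) := (Equiv.prodComm ℤ ℤ).trans (finTwoArrowEquiv ℤ).symm
  refine (e.summable_iff.mpr h2).congr fun p ↦ ?_
  have h3 : ‖((p.2 : ℤ) : ℂ) * (z : ℂ) + ((p.1 : ℤ) : ℂ)‖ ^ 2 =
      (p.1 : ℝ) ^ 2 + Δ ^ 2 * (p.2 : ℝ) ^ 2 := by
    rw [Complex.sq_norm, Complex.normSq_apply]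
    simp [z]
    ring
  simp only [e, Function.comp_apply, Equiv.trans_apply, Equiv.prodComm_apply,
    finTwoArrowEquiv_symm_apply, Prod.fst_swap, Prod.snd_swap, Matrix.cons_val_zero,
    Matrix.cons_val_one]
  rw [← h3, ← Real.rpow_natCast, ← Real.rpow_mul (norm_nonneg _)]
  norm_num

lemma mellin_rectTheta_sub_one {Δ : ℝ} (hΔ : 0 < Δ) {s : ℂ} (hs : 1 < s.re) :
    mellin (fun t ↦ (rectTheta Δ t : ℂ) - 1) s =
      2 * (((Δ / Real.pi : ℝ) : ℂ) ^ s * Complex.Gamma s * epsteinZeta2 s Δ) := by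
  have hq (p : {p : ℤ × ℤ // p ≠ 0}) :
      0 < ((p.1.1 : ℝ) ^ 2 + Δ ^ 2 * (p.1.2 : ℝ) ^ 2) / Δ :=
    div_pos (rect_norm_sq_pos hΔ p.2) hΔ
  have h := hasSum_mellin_pi_mul (a := fun _ ↦ 1)
    (q := fun p : {p : ℤ × ℤ // p ≠ 0} ↦
      ((p.1.1 : ℝ) ^ 2 + Δ ^ 2 * (p.1.2 : ℝ) ^ 2) / Δ)
    (F := fun t ↦ (rectTheta Δ t : ℂ) - 1) (s := s)
    (fun p ↦ Or.inr (hq p)) (by linarith) (fun t ht ↦ ?_) ?_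
  · rw [← h.tsum_eq, epsteinZeta2, ← mul_assoc, ← mul_assoc, ← tsum_mul_left]
    refine tsum_congr fun p ↦ ?_
    have hp := rect_norm_sq_pos hΔ p.2
    rw [mul_one, Complex.ofReal_div, Complex.ofReal_div,
      Complex.div_cpow_ofReal_nonneg hp.le hΔ.le,
      Complex.div_cpow_ofReal_nonneg hΔ.le Real.pi_pos.le, Complex.cpow_neg, Complex.cpow_neg]
    field_simp
  · simpa using Complex.hasSum_ofReal.mpr (hasSum_rectTheta_sub_one hΔ ht)
  · refine ((summable_rect_rpow hΔ hs).subtype {p | p ≠ 0}).mul_left (Δ ^ s.re) |>.congr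
      fun p ↦ ?_
    have hp := rect_norm_sq_pos hΔ p.2
    simp only [norm_one, Function.comp_apply]
    rw [Real.div_rpow hp.le hΔ.le, Real.rpow_neg hp.le]
    field_simp

lemma rectThetaFEPair_Λ₀ {Δ : ℝ} (hΔ : 0 < Δ) (s : ℂ) :
    (rectThetaFEPair hΔ).Λ₀ s = ∫ t in Ioo (0 : ℝ) 1,
      ((t : ℂ) ^ (s - 1) + (t : ℂ) ^ (-s)) * ((rectTheta Δ t - 1 / t : ℝ) : ℂ) := by
  set P := rectThetaFEPair hΔ
  set φ : ℝ → ℂ := fun t ↦ ((rectTheta Δ t - 1 / t : ℝ) : ℂ)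
  set A : ℝ → ℂ := (Ioi 1).indicator fun t ↦ (rectTheta Δ t : ℂ) - 1
  set B : ℝ → ℂ := (Ioo 0 1).indicator φ
  have hAB : P.f_modif = A + B := by
    rw [WeakFEPair.f_modif]
    congr 1
    refine indicator_congr fun t ht ↦ ?_
    simp [P, φ, rectThetaFEPair, Real.rpow_neg_one]
  have hm (s : ℂ) : MellinConvergent P.f_modif s :=
    (P.isStrongFEPair_toStrongFEPair.hasMellin s).1
  have hA (s : ℂ) : MellinConvergent A s := by
    refine ((hm s).indicator measurableSet_Ioi (t := Ioi 1)).congr_fun (fun t _ ↦ ?_)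
      measurableSet_Ioi
    by_cases h : 1 < t
    · simp [hAB, A, B, h, h.le]
    · simp [A, h]
  have hB (s : ℂ) : MellinConvergent B s := by
    refine ((hm s).sub (hA s)).congr_fun (fun t _ ↦ ?_) measurableSet_Ioi
    simp [hAB, mul_add]
  have hBs (s : ℂ) : mellin B s = ∫ t in Ioo (0 : ℝ) 1, (t : ℂ) ^ (s - 1) * φ t := by
    rw [mellin]
    simp_rw [B, smul_eq_mul, ← indicator_mul_right (Ioo (0 : ℝ) 1) (fun t : ℝ ↦ (t : ℂ) ^ (s - 1))]
    rw [setIntegral_indicator measurableSet_Ioo,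
      inter_eq_right.mpr Ioo_subset_Ioi_self]
  have hBi (s : ℂ) : IntegrableOn (fun t : ℝ ↦ (t : ℂ) ^ (s - 1) * φ t) (Ioo 0 1) :=
    ((hB s).mono_set Ioo_subset_Ioi_self).congr_fun
      (fun t ht ↦ by simp [B, indicator_of_mem ht]) measurableSet_Ioo
  have hinv (t : ℝ) (ht : 0 < t) : A t⁻¹ = t * B t := by
    by_cases h : t < 1
    · have h' : 1 < t⁻¹ := (one_lt_inv₀ ht).mpr h
      simp only [A, B, φ, indicator_of_mem (mem_Ioi.mpr h'), indicator_of_mem (mem_Ioo.mpr ⟨ht, h⟩)]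
      rw [← one_div t, rectTheta_one_div hΔ ht]
      have : (t : ℂ) ≠ 0 := by exact_mod_cast ht.ne'
      push_cast
      field_simp
    · have h' : ¬ 1 < t⁻¹ := by rwa [one_lt_inv₀ ht]
      simp [A, B, h, h']
  have hAs : mellin A s = mellin B (1 - s) := by
    rw [← neg_neg s, ← mellin_comp_inv, neg_neg]
    refine setIntegral_congr_fun measurableSet_Ioi fun t ht ↦ ?_
    have ht' : (t : ℂ) ≠ 0 := by exact_mod_cast (mem_Ioi.mp ht).ne'
    simp only [hinv t ht, smul_eq_mul]
    rw [show 1 - s - 1 = (-s - 1) + 1 by ring, Complex.cpow_add _ _ ht', Complex.cpow_one]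
    ring
  have hsum : P.Λ₀ s = mellin A s + mellin B s := by
    rw [WeakFEPair.Λ₀, hAB]
    exact (hasMellin_add (hA s) (hB s)).2
  rw [hsum, hAs, hBs, hBs, ← integral_add (hBi _) (hBi _)]
  refine setIntegral_congr_fun measurableSet_Ioo fun t _ ↦ ?_
  simp only [sub_sub_cancel_left]
  ring

/-- for `Δ > 0` and `Re s > 1`, `(Δ/π)^s Γ(s) ζ⁽²⁾(s,Δ) = F(s,Δ)`. -/
theorem epstein_eq_F (Δ : ℝ) (hΔ : 0 < Δ) (s : ℂ) (hs : 1 < s.re) :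
    ((Δ / Real.pi : ℝ) : ℂ) ^ s * Complex.Gamma s * epsteinZeta2 s Δ = F s Δ := by
  have h := ((rectThetaFEPair hΔ).hasMellin (s := s) hs).2
  have h1 : mellin (fun t ↦ (rectTheta Δ t : ℂ) - 1) s = (rectThetaFEPair hΔ).Λ s := h
  rw [mellin_rectTheta_sub_one hΔ hs, WeakFEPair.Λ, rectThetaFEPair_Λ₀] at h1
  have h2 : F s Δ = -(1 / 2) * (1 / (1 - s) + 1 / s) + (1 / 2) * ∫ t in Ioo (0 : ℝ) 1,
      ((t : ℂ) ^ (s - 1) + (t : ℂ) ^ (-s)) * ((rectTheta Δ t - 1 / t : ℝ) : ℂ) := by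
    rw [F]
    congr 2
    refine setIntegral_congr_fun measurableSet_Ioo fun t ht ↦ ?_
    simp only [theta3_mul_theta3 hΔ ht.1]
  rw [h2]
  simp only [rectThetaFEPair, smul_eq_mul, Complex.ofReal_one, mul_one] at h1
  linear_combination h1 / 2
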